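/- Let A, B, C be affinely independent points in the Euclidean plane ℝ² with side lengths a = dist(B,C), b = dist(C,A), c = dist(A,B), area S > 0, and inradius r = 2S/(a+b+c). For D ∈ ℝ² and h > 0 define A(D,h) = S + ½·( a·√(d(D, ℓ_{BC})² + h²) + b·√(d(D, ℓ_{CA})² + h²) + c·√(d(D, ℓ_{AB})² + h²) ) and V(D,h) = S·h/3, where d(D, ℓ) is the distance from D to the line through the indicated vertices. Then the function (D, h) ↦ A(D,h)³ / V(D,h)² on ℝ² × (0, ∞) attains its global minimum, equal to 72·S/r², exactly at D = incenter of ABC and h = 2√2 · r. -/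

import Mathlib

/-- The line in the Euclidean plane through two points, as a set. -/
noncomputable def sideLine (X Y : EuclideanSpace ℝ (Fin 2)) : Set (EuclideanSpace ℝ (Fin 2)) :=
  (affineSpan ℝ {X, Y} : AffineSubspace ℝ (EuclideanSpace ℝ (Fin 2)))

/-- The incenter of the triangle `ABC`, given by its barycentric coordinates
`(a : b : c)` where `a, b, c` are the side lengths. -/
noncomputable def triIncenter (A B C : EuclideanSpace ℝ (Fin 2)) : EuclideanSpace ℝ (Fin 2) :=
  (dist B C + dist C A + dist A B)⁻¹ •
    (dist B C • A + dist C A • B + dist A B • C)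

/-- The area of the triangle `ABC` (the Lebesgue measure of its convex hull). -/
noncomputable def triArea (A B C : EuclideanSpace ℝ (Fin 2)) : ℝ :=
  (MeasureTheory.volume (convexHull ℝ ({A, B, C} : Set (EuclideanSpace ℝ (Fin 2))))).toReal

open MeasureTheory

/-- The planar cross product of `Y - X` and `Z - X`, twice the signed area of `XYZ`. -/
noncomputable def planeCross (X Y Z : EuclideanSpace ℝ (Fin 2)) : ℝ :=
  (Y 0 - X 0) * (Z 1 - X 1) - (Y 1 - X 1) * (Z 0 - X 0)

lemma dist_sq_plane (X Y : EuclideanSpace ℝ (Fin 2)) :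
    dist X Y ^ 2 = (X 0 - Y 0) ^ 2 + (X 1 - Y 1) ^ 2 := by
  rw [EuclideanSpace.dist_eq, Real.sq_sqrt (by positivity), Fin.sum_univ_two,
    Real.dist_eq, Real.dist_eq, sq_abs, sq_abs]

lemma mem_sideLine {X Y P : EuclideanSpace ℝ (Fin 2)} :
    P ∈ sideLine X Y ↔ ∃ t : ℝ, AffineMap.lineMap X Y t = P := by
  rw [sideLine, SetLike.mem_coe, mem_affineSpan_pair_iff_exists_lineMap_eq]

lemma lineMap_apply_coord (X Y : EuclideanSpace ℝ (Fin 2)) (t : ℝ) (i : Fin 2) :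
    (AffineMap.lineMap X Y t : EuclideanSpace ℝ (Fin 2)) i = X i + t * (Y i - X i) := by
  simp [AffineMap.lineMap_apply]
  ring

lemma infDist_sideLine_mul_dist {X Y : EuclideanSpace ℝ (Fin 2)} (hXY : X ≠ Y)
    (D : EuclideanSpace ℝ (Fin 2)) :
    dist X Y * Metric.infDist D (sideLine X Y) = |planeCross D X Y| := by
  have hpos : 0 < dist X Y := dist_pos.mpr hXY
  have hd := dist_sq_plane X Y
  have hlagrange : ∀ t : ℝ, (dist X Y * dist D (AffineMap.lineMap X Y t)) ^ 2 =
      planeCross D X Y ^ 2 + ((D 0 - X 0) * (Y 0 - X 0) + (D 1 - X 1) * (Y 1 - X 1)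
        - t * dist X Y ^ 2) ^ 2 := by
    intro t
    rw [mul_pow, dist_sq_plane D, lineMap_apply_coord, lineMap_apply_coord, hd, planeCross]
    ring
  apply le_antisymm
  · set t := ((D 0 - X 0) * (Y 0 - X 0) + (D 1 - X 1) * (Y 1 - X 1)) / dist X Y ^ 2 with ht
    have hle : Metric.infDist D (sideLine X Y) ≤ dist D (AffineMap.lineMap X Y t) :=
      Metric.infDist_le_dist_of_mem (mem_sideLine.mpr ⟨t, rfl⟩)
    refine (mul_le_mul_of_nonneg_left hle hpos.le).trans (le_of_eq ?_)
    have h := hlagrange t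
    rw [ht, div_mul_cancel₀ _ (by positivity), sub_self, ← ht] at h
    rw [← abs_of_nonneg (show 0 ≤ dist X Y * dist D (AffineMap.lineMap X Y t) by positivity)]
    exact (sq_eq_sq_iff_abs_eq_abs _ _).mp (by linarith)
  · rw [← div_le_iff₀' hpos]
    refine (Metric.le_infDist ⟨X, mem_sideLine.mpr ⟨0, by simp⟩⟩).mpr ?_
    intro P hP
    obtain ⟨t, rfl⟩ := mem_sideLine.mp hP
    rw [div_le_iff₀' hpos]
    refine abs_le_of_sq_le_sq ?_ (mul_nonneg dist_nonneg dist_nonneg)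
    rw [hlagrange t]
    nlinarith [sq_nonneg ((D 0 - X 0) * (Y 0 - X 0) + (D 1 - X 1) * (Y 1 - X 1)
        - t * dist X Y ^ 2)]

lemma volume_standard_triangle_prod :
    volume {p : ℝ × ℝ | 0 ≤ p.1 ∧ 0 ≤ p.2 ∧ p.1 + p.2 ≤ 1} = ENNReal.ofReal (1 / 2) := by
  have hmeas : MeasurableSet {p : ℝ × ℝ | 0 ≤ p.1 ∧ 0 ≤ p.2 ∧ p.1 + p.2 ≤ 1} := by
    apply IsClosed.measurableSet
    simp only [Set.ofPred_and]
    exact (isClosed_le (by fun_prop) (by fun_prop)).inter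
      ((isClosed_le (by fun_prop) (by fun_prop)).inter
        (isClosed_le (by fun_prop) (by fun_prop)))
  rw [Measure.volume_eq_prod, Measure.prod_apply hmeas]
  have hslice : ∀ x : ℝ, volume (Prod.mk x ⁻¹' {p : ℝ × ℝ | 0 ≤ p.1 ∧ 0 ≤ p.2 ∧ p.1 + p.2 ≤ 1})
      = (Set.Icc (0 : ℝ) 1).indicator (fun x => ENNReal.ofReal (1 - x)) x := by
    intro x
    by_cases hx : 0 ≤ x
    · have : Prod.mk x ⁻¹' {p : ℝ × ℝ | 0 ≤ p.1 ∧ 0 ≤ p.2 ∧ p.1 + p.2 ≤ 1}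
          = Set.Icc 0 (1 - x) := by
        ext y
        simp only [Set.mem_preimage, Set.mem_ofPred_eq, Set.mem_Icc, hx, true_and, le_sub_iff_add_le']
      rw [this, Real.volume_Icc, sub_zero]
      by_cases hx1 : x ≤ 1
      · rw [Set.indicator_of_mem (Set.mem_Icc.mpr ⟨hx, hx1⟩)]
      · rw [Set.indicator_of_notMem (fun h => hx1 h.2), ENNReal.ofReal_of_nonpos (by linarith)]
    · rw [Set.indicator_of_notMem (fun h => hx h.1)]
      have : Prod.mk x ⁻¹' {p : ℝ × ℝ | 0 ≤ p.1 ∧ 0 ≤ p.2 ∧ p.1 + p.2 ≤ 1} = ∅ := by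
        ext y
        simp [hx]
      rw [this, measure_empty]
  simp_rw [hslice]
  rw [lintegral_indicator measurableSet_Icc, ← ofReal_integral_eq_lintegral_ofReal]
  · rw [integral_Icc_eq_integral_Ioc, ← intervalIntegral.integral_of_le zero_le_one]
    congr 1
    rw [intervalIntegral.integral_sub (by simp) (by simp)]
    simp
    norm_num
  · exact (Continuous.integrableOn_Icc (by fun_prop))
  · filter_upwards [ae_restrict_mem measurableSet_Icc] with x hx
    simpa using hx.2

lemma volume_standard_triangle :
    volume {x : EuclideanSpace ℝ (Fin 2) | 0 ≤ x 0 ∧ 0 ≤ x 1 ∧ x 0 + x 1 ≤ 1}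
      = ENNReal.ofReal (1 / 2) := by
  rw [← volume_standard_triangle_prod]
  have h := (volume_preserving_finTwoArrow ℝ).comp (PiLp.volume_preserving_ofLp (Fin 2))
  rw [← h.measure_preimage]
  · rfl
  · apply MeasurableSet.nullMeasurableSet
    apply IsClosed.measurableSet
    simp only [Set.ofPred_and]
    exact (isClosed_le (by fun_prop) (by fun_prop)).inter
      ((isClosed_le (by fun_prop) (by fun_prop)).inter
        (isClosed_le (by fun_prop) (by fun_prop)))

/-- The linear map sending the standard basis to the edge vectors `B - A` and `C - A`. -/
noncomputable def edgeMap (A B C : EuclideanSpace ℝ (Fin 2)) :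
    EuclideanSpace ℝ (Fin 2) →ₗ[ℝ] EuclideanSpace ℝ (Fin 2) :=
  Matrix.toEuclideanLin !![B 0 - A 0, C 0 - A 0; B 1 - A 1, C 1 - A 1]

lemma edgeMap_apply (A B C x : EuclideanSpace ℝ (Fin 2)) :
    edgeMap A B C x = x 0 • (B - A) + x 1 • (C - A) := by
  ext i
  fin_cases i <;>
    simp [edgeMap, Matrix.toLpLin_apply, dotProduct, Fin.sum_univ_two] <;> ring

lemma det_edgeMap (A B C : EuclideanSpace ℝ (Fin 2)) :
    LinearMap.det (edgeMap A B C) = planeCross A B C := by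
  rw [edgeMap, Matrix.toEuclideanLin_eq_toLin_orthonormal, LinearMap.det_toLin,
    Matrix.det_fin_two_of, planeCross]
  ring

lemma convexHull_triangle_eq_image (A B C : EuclideanSpace ℝ (Fin 2)) :
    convexHull ℝ {A, B, C} = (fun x => A + x) '' (edgeMap A B C ''
      {x : EuclideanSpace ℝ (Fin 2) | 0 ≤ x 0 ∧ 0 ≤ x 1 ∧ x 0 + x 1 ≤ 1}) := by
  rw [Set.image_image]
  ext P
  rw [convexHull_insert (Set.insert_nonempty _ _), convexHull_pair, mem_convexJoin]
  simp only [Set.mem_singleton_iff, exists_eq_left, Set.mem_image, edgeMap_apply]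
  constructor
  · rintro ⟨Q, ⟨u, v, hu, hv, huv, rfl⟩, s, t, hs, ht, hst, rfl⟩
    refine ⟨!₂[t * u, t * v], ⟨by simp; positivity, by simp; positivity, ?_⟩, ?_⟩
    · simp
      nlinarith
    · obtain rfl : v = 1 - u := by linarith
      obtain rfl : s = 1 - t := by linarith
      simp
      module
  · rintro ⟨x, ⟨h0, h1, h01⟩, rfl⟩
    rcases (add_nonneg h0 h1).eq_or_lt with h | h
    · have hx0 : x 0 = 0 := by linarith
      have hx1 : x 1 = 0 := by linarith
      refine ⟨B, left_mem_segment ℝ B C, ?_⟩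
      rw [hx0, hx1]
      simpa using left_mem_segment ℝ A B
    · refine ⟨(x 0 / (x 0 + x 1)) • B + (x 1 / (x 0 + x 1)) • C,
        ⟨_, _, by positivity, by positivity, by field_simp, rfl⟩,
        1 - (x 0 + x 1), x 0 + x 1, by linarith, h.le, by ring, ?_⟩
      rw [smul_add, smul_smul, smul_smul, mul_div_cancel₀ _ h.ne', mul_div_cancel₀ _ h.ne']
      module

lemma triArea_eq (A B C : EuclideanSpace ℝ (Fin 2)) :
    triArea A B C = |planeCross A B C| / 2 := by
  rw [triArea, convexHull_triangle_eq_image, Set.image_add_left, measure_preimage_add,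
    Measure.addHaar_image_linearMap, volume_standard_triangle, det_edgeMap,
    ← ENNReal.ofReal_mul (abs_nonneg _), ENNReal.toReal_ofReal (by positivity)]
  ring

lemma add_sq_le_mul_sqrt {r h s x : ℝ} (hs0 : 0 ≤ s) (hs : s ^ 2 = r ^ 2 + h ^ 2) :
    r * x + h ^ 2 ≤ s * √(x ^ 2 + h ^ 2) := by
  refine le_of_sq_le_sq ?_ (by positivity)
  rw [mul_pow, Real.sq_sqrt (by positivity), hs]
  nlinarith [sq_nonneg (h * (x - r))]

lemma eq_of_add_sq_eq_mul_sqrt {r h s x : ℝ} (hh : 0 < h) (hs : s ^ 2 = r ^ 2 + h ^ 2)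
    (heq : r * x + h ^ 2 = s * √(x ^ 2 + h ^ 2)) : x = r := by
  have h2 := congrArg (· ^ 2) heq
  simp only [mul_pow, Real.sq_sqrt (show 0 ≤ x ^ 2 + h ^ 2 by positivity), hs] at h2
  have h3 : (h * (x - r)) ^ 2 = 0 := by linear_combination -h2
  have h4 := (mul_eq_zero.mp (pow_eq_zero_iff two_ne_zero |>.mp h3)).resolve_left hh.ne'
  linarith

section ConeRatio

variable {a b c r h s x y z : ℝ}

lemma perimeter_mul_le_sum_sqrt (ha : 0 < a) (hb : 0 < b) (hc : 0 < c) (hr : 0 < r)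
    (hs0 : 0 < s) (hs : s ^ 2 = r ^ 2 + h ^ 2)
    (hsum : (a + b + c) * r ≤ a * x + b * y + c * z) :
    (a + b + c) * s ≤ a * √(x ^ 2 + h ^ 2) + b * √(y ^ 2 + h ^ 2) + c * √(z ^ 2 + h ^ 2) := by
  have hx := mul_le_mul_of_nonneg_left (add_sq_le_mul_sqrt (x := x) hs0.le hs) ha.le
  have hy := mul_le_mul_of_nonneg_left (add_sq_le_mul_sqrt (x := y) hs0.le hs) hb.le
  have hz := mul_le_mul_of_nonneg_left (add_sq_le_mul_sqrt (x := z) hs0.le hs) hc.le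
  have hm := mul_le_mul_of_nonneg_left hsum hr.le
  refine le_of_mul_le_mul_left ?_ hs0
  linear_combination hx + hy + hz + hm + (a + b + c) * hs

lemma eq_of_sum_sqrt_eq (ha : 0 < a) (hb : 0 < b) (hc : 0 < c) (hr : 0 < r) (hh : 0 < h)
    (hs0 : 0 < s) (hs : s ^ 2 = r ^ 2 + h ^ 2)
    (hsum : (a + b + c) * r ≤ a * x + b * y + c * z)
    (heq : a * √(x ^ 2 + h ^ 2) + b * √(y ^ 2 + h ^ 2) + c * √(z ^ 2 + h ^ 2) =
      (a + b + c) * s) :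
    x = r ∧ y = r ∧ z = r := by
  have hx := mul_le_mul_of_nonneg_left (add_sq_le_mul_sqrt (x := x) hs0.le hs) ha.le
  have hy := mul_le_mul_of_nonneg_left (add_sq_le_mul_sqrt (x := y) hs0.le hs) hb.le
  have hz := mul_le_mul_of_nonneg_left (add_sq_le_mul_sqrt (x := z) hs0.le hs) hc.le
  have hm := mul_le_mul_of_nonneg_left hsum hr.le
  have htotal := congrArg (s * ·) heq
  refine ⟨eq_of_add_sq_eq_mul_sqrt hh hs (mul_left_cancel₀ ha.ne' (le_antisymm hx ?_)),
    eq_of_add_sq_eq_mul_sqrt hh hs (mul_left_cancel₀ hb.ne' (le_antisymm hy ?_)),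
    eq_of_add_sq_eq_mul_sqrt hh hs (mul_left_cancel₀ hc.ne' (le_antisymm hz ?_))⟩
  · linear_combination hy + hz + hm + (a + b + c) * hs + htotal
  · linear_combination hx + hz + hm + (a + b + c) * hs + htotal
  · linear_combination hx + hy + hm + (a + b + c) * hs + htotal

/-- The optimization underlying the cone isoperimetric problem, in terms of the distances
`x, y, z` to the side lines of a triangle with sides `a, b, c` and inradius `r`. -/
lemma cone_ratio_min {S Ar V : ℝ} (ha : 0 < a) (hb : 0 < b) (hc : 0 < c) (hr : 0 < r)
    (hh : 0 < h) (hsum : (a + b + c) * r ≤ a * x + b * y + c * z)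
    (hS : 2 * S = (a + b + c) * r)
    (hAr : Ar = S + 1 / 2 *
      (a * √(x ^ 2 + h ^ 2) + b * √(y ^ 2 + h ^ 2) + c * √(z ^ 2 + h ^ 2)))
    (hV : V = S * h / 3) :
    72 * S / r ^ 2 ≤ Ar ^ 3 / V ^ 2 ∧
      (Ar ^ 3 / V ^ 2 = 72 * S / r ^ 2 ↔ (x = r ∧ y = r ∧ z = r) ∧ h = 2 * √2 * r) := by
  obtain ⟨s, hs0, hs⟩ : ∃ s : ℝ, 0 < s ∧ s ^ 2 = r ^ 2 + h ^ 2 :=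
    ⟨√(r ^ 2 + h ^ 2), by positivity, Real.sq_sqrt (by positivity)⟩
  have hp : 0 < a + b + c := by positivity
  have hS0 : 0 < S := by nlinarith [mul_pos hp hr]
  have hV0 : 0 < V := by rw [hV]; positivity
  have hle := perimeter_mul_le_sum_sqrt ha hb hc hr hs0 hs hsum
  have hA : (a + b + c) * (r + s) / 2 ≤ Ar := by
    rw [hAr]
    linarith
  have hA3 : ((a + b + c) * (r + s) / 2) ^ 3 ≤ Ar ^ 3 := by gcongr
  have hvol : 72 * S / r ^ 2 * V ^ 2 = (a + b + c) ^ 3 * (r * h ^ 2) := by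
    obtain rfl : S = (a + b + c) * r / 2 := by linarith
    rw [hV]
    field_simp
    norm_num
  have hcube : ((a + b + c) * (r + s) / 2) ^ 3 =
      (a + b + c) ^ 3 * (r * h ^ 2) + (a + b + c) ^ 3 * ((r + s) * (s - 3 * r) ^ 2) / 8 := by
    linear_combination (a + b + c) ^ 3 * r * hs
  have hdef : 0 ≤ (a + b + c) ^ 3 * ((r + s) * (s - 3 * r) ^ 2) := by positivity
  constructor
  · rw [le_div_iff₀ (by positivity), hvol]
    linarith
  rw [div_eq_iff (by positivity), hvol]
  constructor
  · intro heq
    have h0 : (a + b + c) ^ 3 * ((r + s) * (s - 3 * r) ^ 2) = 0 := by linarith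
    have hs3 : s - 3 * r = 0 := by
      have h1 := (mul_eq_zero.mp h0).resolve_left (by positivity)
      have h2 := (mul_eq_zero.mp h1).resolve_left (by positivity)
      exact pow_eq_zero_iff two_ne_zero |>.mp h2
    have hAeq : Ar = (a + b + c) * (r + s) / 2 := by
      refine (pow_left_inj₀ (by linarith [show 0 < (a + b + c) * (r + s) by positivity])
        (by positivity) three_ne_zero).mp ?_
      linarith
    refine ⟨eq_of_sum_sqrt_eq ha hb hc hr hh hs0 hs hsum (by linarith), ?_⟩
    refine (pow_left_inj₀ hh.le (by positivity) two_ne_zero).mp ?_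
    obtain rfl : s = 3 * r := by linarith
    rw [mul_pow, mul_pow, Real.sq_sqrt (by norm_num)]
    linarith
  · rintro ⟨⟨rfl, rfl, rfl⟩, hhr⟩
    have hh2 : h ^ 2 = 8 * z ^ 2 := by
      rw [hhr, mul_pow, mul_pow, Real.sq_sqrt (by norm_num)]
      ring
    have hsz : √(z ^ 2 + h ^ 2) = 3 * z := by
      rw [hh2, Real.sqrt_eq_iff_mul_self_eq (by positivity) (by positivity)]
      ring
    obtain rfl : S = (a + b + c) * z / 2 := by linarith
    rw [hAr, hsz, hh2]
    ring

end ConeRatio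

/-- Scaled barycentric coordinates of the point `D` in the triangle `ABC`. -/
lemma planeCross_add_add (A B C D : EuclideanSpace ℝ (Fin 2)) :
    planeCross D B C + planeCross D C A + planeCross D A B = planeCross A B C := by
  simp only [planeCross]
  ring

lemma planeCross_smul_add_add (A B C D : EuclideanSpace ℝ (Fin 2)) (i : Fin 2) :
    planeCross D B C * A i + planeCross D C A * B i + planeCross D A B * C i =
      planeCross A B C * D i := by
  fin_cases i <;> simp [planeCross] <;> ring

lemma abs_eq_iff_of_add_add {u v w d a b c r : ℝ} (hd : u + v + w = d)
    (habs : |d| = (a + b + c) * r) (ha : 0 < a) (hb : 0 < b)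
    (hc : 0 < c) :
    (|u| = a * r ∧ |v| = b * r ∧ |w| = c * r) ↔
      (a + b + c) * u = a * d ∧ (a + b + c) * v = b * d ∧ (a + b + c) * w = c * d := by
  have hp : 0 < a + b + c := by positivity
  constructor
  · rintro ⟨hu, hv, hw⟩
    rcases abs_cases d with ⟨h1, h2⟩ | ⟨h1, h2⟩
    · have := le_abs_self u
      have := le_abs_self v
      have := le_abs_self w
      have h3 : u = a * r := by linarith
      have h4 : v = b * r := by linarith
      have h5 : w = c * r := by linarith
      have h6 : d = (a + b + c) * r := by linarith
      subst h3 h4 h5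
      rw [h6]
      refine ⟨?_, ?_, ?_⟩ <;> ring
    · have := neg_le_abs u
      have := neg_le_abs v
      have := neg_le_abs w
      have h3 : u = -(a * r) := by linarith
      have h4 : v = -(b * r) := by linarith
      have h5 : w = -(c * r) := by linarith
      have h6 : d = -((a + b + c) * r) := by linarith
      subst h3 h4 h5
      rw [h6]
      refine ⟨?_, ?_, ?_⟩ <;> ring
  · have key : ∀ {k t : ℝ}, 0 < k → (a + b + c) * t = k * d → |t| = k * r := by
      intro k t hk ht
      have h1 := congrArg abs ht
      rw [abs_mul, abs_mul, abs_of_pos hp, abs_of_pos hk, habs] at h1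
      refine mul_left_cancel₀ hp.ne' ?_
      linarith
    rintro ⟨hu, hv, hw⟩
    exact ⟨key ha hu, key hb hv, key hc hw⟩

lemma eq_triIncenter_iff {A B C D : EuclideanSpace ℝ (Fin 2)} {a b c : ℝ}
    (ha : a = dist B C) (hb : b = dist C A) (hc : c = dist A B) (hp : 0 < a + b + c)
    (hd : planeCross A B C ≠ 0) :
    D = triIncenter A B C ↔
      (a + b + c) * planeCross D B C = a * planeCross A B C ∧
      (a + b + c) * planeCross D C A = b * planeCross A B C ∧
      (a + b + c) * planeCross D A B = c * planeCross A B C := by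
  have hcoord : D = triIncenter A B C ↔
      ∀ i, (a + b + c) * D i = a * A i + b * B i + c * C i := by
    rw [triIncenter, ← ha, ← hb, ← hc, eq_inv_smul_iff₀ hp.ne', PiLp.ext_iff]
    simp
  rw [hcoord]
  constructor
  · intro h
    have h0 := h 0
    have h1 := h 1
    simp only [planeCross]
    refine ⟨?_, ?_, ?_⟩
    · linear_combination (B 1 - C 1) * h0 - (B 0 - C 0) * h1
    · linear_combination (C 1 - A 1) * h0 - (C 0 - A 0) * h1
    · linear_combination (A 1 - B 1) * h0 - (A 0 - B 0) * h1
  · rintro ⟨hu, hv, hw⟩ i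
    refine mul_left_cancel₀ hd ?_
    linear_combination A i * hu + B i * hv + C i * hw -
      (a + b + c) * planeCross_smul_add_add A B C D i

/-- For a triangle with area `S` and inradius `r = 2S/(a+b+c)`, the cone isoperimetric
ratio `A(D,h)³ / V(D,h)²`, where `A(D,h)` is the total boundary area and `V(D,h) = S·h/3`
the volume of the cone with apex `(D, h)`, attains its global minimum `72·S/r²` on
`ℝ² × (0, ∞)` exactly at `D =` incenter and `h = 2√2·r`. -/
theorem stmt_8 (A B C : EuclideanSpace ℝ (Fin 2))
    (hABC : AffineIndependent ℝ ![A, B, C])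
    (a b c : ℝ) (ha : a = dist B C) (hb : b = dist C A) (hc : c = dist A B)
    (S r : ℝ) (hS : S = triArea A B C) (hSpos : 0 < S) (hr : r = 2 * S / (a + b + c))
    (Ar V : EuclideanSpace ℝ (Fin 2) → ℝ → ℝ)
    (hAr : ∀ D h, Ar D h = S + (1 / 2) *
      (a * Real.sqrt (Metric.infDist D (sideLine B C) ^ 2 + h ^ 2) +
       b * Real.sqrt (Metric.infDist D (sideLine C A) ^ 2 + h ^ 2) +
       c * Real.sqrt (Metric.infDist D (sideLine A B) ^ 2 + h ^ 2)))
    (hV : ∀ D h, V D h = S * h / 3) :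
    ∀ D : EuclideanSpace ℝ (Fin 2), ∀ h : ℝ, 0 < h →
      72 * S / r ^ 2 ≤ Ar D h ^ 3 / V D h ^ 2 ∧
      (Ar D h ^ 3 / V D h ^ 2 = 72 * S / r ^ 2 ↔
        D = triIncenter A B C ∧ h = 2 * Real.sqrt 2 * r) := by
  obtain ⟨hBC, hCA, hAB⟩ : B ≠ C ∧ C ≠ A ∧ A ≠ B := by
    have hinj := hABC.injective
    exact ⟨fun h => absurd (@hinj 1 2 h) (by decide), fun h => absurd (@hinj 2 0 h) (by decide),
      fun h => absurd (@hinj 0 1 h) (by decide)⟩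
  intro D h hh
  have ha0 : 0 < a := ha ▸ dist_pos.mpr hBC
  have hb0 : 0 < b := hb ▸ dist_pos.mpr hCA
  have hc0 : 0 < c := hc ▸ dist_pos.mpr hAB
  have hp : 0 < a + b + c := by positivity
  have hr0 : 0 < r := by rw [hr]; positivity
  have hSr : 2 * S = (a + b + c) * r := by rw [hr]; field_simp
  have habs : |planeCross A B C| = (a + b + c) * r := by
    rw [← hSr, hS, triArea_eq]
    ring
  have hd : planeCross A B C ≠ 0 := by
    rw [← abs_pos, habs]
    positivity
  have hx := infDist_sideLine_mul_dist hBC D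
  have hy := infDist_sideLine_mul_dist hCA D
  have hz := infDist_sideLine_mul_dist hAB D
  rw [← ha] at hx
  rw [← hb] at hy
  rw [← hc] at hz
  have hsum : (a + b + c) * r ≤ a * Metric.infDist D (sideLine B C) +
      b * Metric.infDist D (sideLine C A) + c * Metric.infDist D (sideLine A B) := by
    rw [hx, hy, hz, ← habs, ← planeCross_add_add A B C D]
    exact abs_add_three _ _ _
  have hmin := cone_ratio_min ha0 hb0 hc0 hr0 hh hsum hSr (hAr D h) (hV D h)
  refine ⟨hmin.1, hmin.2.trans (and_congr_left' ?_)⟩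
  rw [eq_triIncenter_iff ha hb hc hp hd, ← abs_eq_iff_of_add_add (planeCross_add_add A B C D)
    habs ha0 hb0 hc0, ← hx, ← hy, ← hz, mul_right_inj' ha0.ne',
    mul_right_inj' hb0.ne', mul_right_inj' hc0.ne']
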